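/- Let f : ℝ^m × ℝ^n → ℝ be ℓ-smooth with f(x,·) μ-strongly concave on convex Y, κ = ℓ/μ, and let Φ(x) = max_{y∈Y} f(x,y). If a pair (x̂, ŷ) ∈ ℝ^m × Y satisfies ‖∇_x f(x̂, ŷ)‖ ≤ ε/κ and ‖P_Y(ŷ + (1/ℓ)∇_y f(x̂, ŷ)) − ŷ‖ ≤ ε/(κℓ), then ‖∇Φ(x̂)‖ ≤ 2ε. -/

import Mathlib

open Set
open scoped RealInnerProductSpace
open Filter Topology

section ErrorBound

variable {E : Type*} [NormedAddCommGroup E] [InnerProductSpace ℝ E]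

theorem StrongConcaveOn.second_difference_le {Y : Set E} {μ : ℝ} {g : E → ℝ}
    (hg : StrongConcaveOn Y μ g) {c w : E} (h₁ : c + w ∈ Y) (h₂ : c - w ∈ Y) :
    g (c + w) + g (c - w) - 2 * g c ≤ -(μ * ‖w‖ ^ 2) := by
  have hhalf : (0 : ℝ) ≤ 1 / 2 := by norm_num
  have h := hg.2 h₁ h₂ hhalf hhalf (by norm_num)
  rw [show (1 / 2 : ℝ) • (c + w) + (1 / 2 : ℝ) • (c - w) = c by module,
    show (c + w) - (c - w) = (2 : ℝ) • w by module, norm_smul] at h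
  norm_num [smul_eq_mul] at h
  nlinarith

/-- Mixed second differences over a rhombus contained in the domain of strong concavity. -/
theorem StrongConcaveOn.mixed_difference_le {Y : Set E} {μ ℓ : ℝ} {g : E → ℝ}
    (hg : StrongConcaveOn Y μ g) (hμℓ : μ ≤ ℓ)
    (hlow : ∀ c w, -(ℓ * ‖w‖ ^ 2) ≤ g (c + w) + g (c - w) - 2 * g c)
    {a δ v : E} (hnorm : ‖δ‖ = ‖v‖) (ha : a ∈ Y) (hav : a + δ + v ∈ Y) :
    g (a + δ + v) - g (a + δ) - g (a + v) + g a ≤ (ℓ - μ) * (‖δ‖ * ‖v‖) - ℓ * ⟪δ, v⟫ := by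
  have e₁ : a + (1 / 2 : ℝ) • (δ + v) + (1 / 2 : ℝ) • (δ + v) = a + δ + v := by module
  have e₂ : a + (1 / 2 : ℝ) • (δ + v) - (1 / 2 : ℝ) • (δ + v) = a := by module
  have e₃ : a + (1 / 2 : ℝ) • (δ + v) + (1 / 2 : ℝ) • (δ - v) = a + δ := by module
  have e₄ : a + (1 / 2 : ℝ) • (δ + v) - (1 / 2 : ℝ) • (δ - v) = a + v := by module
  have hup := hg.second_difference_le (c := a + (1 / 2 : ℝ) • (δ + v))
    (w := (1 / 2 : ℝ) • (δ + v)) (by rwa [e₁]) (by rwa [e₂])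
  have hlo := hlow (a + (1 / 2 : ℝ) • (δ + v)) ((1 / 2 : ℝ) • (δ - v))
  rw [e₁, e₂, norm_smul, mul_pow, norm_add_sq_real, hnorm] at hup
  rw [e₃, e₄, norm_smul, mul_pow, norm_sub_sq_real, hnorm] at hlo
  norm_num at hup hlo
  have hinner := real_inner_le_norm δ v
  rw [hnorm] at hinner ⊢
  nlinarith [mul_le_mul_of_nonneg_left hinner (sub_nonneg.2 hμℓ)]

theorem Convex.add_smul_add_smul_mem {Y : Set E} (hY : Convex ℝ Y) {y d u : E} (h₀ : y ∈ Y)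
    (h₁ : y + d ∈ Y) (h₂ : y + u ∈ Y) {α β : ℝ} (hα : 0 ≤ α) (hβ : 0 ≤ β) (hαβ : α + β ≤ 1) :
    y + α • d + β • u ∈ Y := by
  have h := hY.sum_mem (t := Finset.univ) (w := ![1 - α - β, α, β]) (z := ![y, y + d, y + u])
    (by intro i _; fin_cases i <;> simp <;> linarith) (by simp [Fin.sum_univ_three]; ring)
    (by intro i _; fin_cases i <;> simpa)
  simp only [Fin.sum_univ_three, Matrix.cons_val] at h
  convert h using 1
  module

variable [CompleteSpace E]

theorem HasGradientAt.hasDerivAt_line {g : E → ℝ} {G a w : E} {t : ℝ}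
    (h : HasGradientAt g G (a + t • w)) :
    HasDerivAt (fun s : ℝ => g (a + s • w)) ⟪G, w⟫ t := by
  have hline : HasDerivAt (fun s : ℝ => a + s • w) w t := by
    simpa using ((hasDerivAt_id t).smul_const w).const_add a
  simpa [Function.comp_def] using h.hasFDerivAt.comp_hasDerivAt t hline

/-- A function with `ℓ`-Lipschitz gradient has second differences bounded below. -/
theorem neg_le_second_difference_of_lipschitz_gradient {g : E → ℝ} {G : E → E} {ℓ : ℝ}
    (hG : ∀ y, HasGradientAt g (G y) y) (hlip : ∀ y y', ‖G y - G y'‖ ≤ ℓ * ‖y - y'‖) (c w : E) :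
    -(ℓ * ‖w‖ ^ 2) ≤ g (c + w) + g (c - w) - 2 * g c := by
  have hder (t : ℝ) : HasDerivAt
      (fun s : ℝ => g (c + s • w) + g (c + s • (-w)) + ℓ * ‖w‖ ^ 2 * s ^ 2)
      (⟪G (c + t • w), w⟫ + ⟪G (c + t • (-w)), -w⟫ + ℓ * ‖w‖ ^ 2 * (2 * t)) t := by
    exact (((hG (c + t • w)).hasDerivAt_line.add (hG (c + t • (-w))).hasDerivAt_line).add
      ((hasDerivAt_pow 2 t).const_mul (ℓ * ‖w‖ ^ 2))).congr_deriv (by simp)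
  have hmono : MonotoneOn
      (fun s : ℝ => g (c + s • w) + g (c + s • (-w)) + ℓ * ‖w‖ ^ 2 * s ^ 2) (Icc 0 1) := by
    refine monotoneOn_of_deriv_nonneg (convex_Icc 0 1)
      (fun t _ => (hder t).continuousAt.continuousWithinAt)
      (fun t _ => (hder t).differentiableAt.differentiableWithinAt) fun t ht => ?_
    rw [interior_Icc] at ht
    rw [(hder t).deriv]
    have hdist : ‖(c + t • w) - (c + t • (-w))‖ = 2 * t * ‖w‖ := by
      rw [show (c + t • w) - (c + t • (-w)) = (2 * t) • w by module, norm_smul,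
        Real.norm_of_nonneg (by linarith [ht.1])]
    have hnorm := hlip (c + t • w) (c + t • (-w))
    rw [hdist] at hnorm
    have hinner := neg_le_of_abs_le
      (abs_real_inner_le_norm (G (c + t • w) - G (c + t • (-w))) w)
    rw [inner_sub_left] at hinner
    rw [inner_neg_right]
    nlinarith [mul_le_mul_of_nonneg_right hnorm (norm_nonneg w)]
  have h01 := hmono (left_mem_Icc.2 zero_le_one) (right_mem_Icc.2 zero_le_one) zero_le_one
  simp only [zero_smul, add_zero, one_smul, ← sub_eq_add_neg] at h01
  linarith

/-- On a triangle in the domain of strong concavity, `y ↦ ℓ y + ∇g y` contracts by `ℓ - μ` when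
tested along the edges at a common vertex. -/
theorem StrongConcaveOn.inner_gradient_sub_le {Y : Set E} {μ ℓ : ℝ} {g : E → ℝ} {G : E → E}
    (hg : StrongConcaveOn Y μ g) (hμℓ : μ ≤ ℓ) (hG : ∀ y, HasGradientAt g (G y) y)
    (hlip : ∀ y y', ‖G y - G y'‖ ≤ ℓ * ‖y - y'‖) {y d u : E} (h₀ : y ∈ Y)
    (h₁ : y + d ∈ Y) (h₂ : y + u ∈ Y) :
    ⟪G (y + d) - G y, u⟫ ≤ (ℓ - μ) * (‖d‖ * ‖u‖) - ℓ * ⟪d, u⟫ := by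
  rcases eq_or_ne d 0 with rfl | hd
  · simp
  rcases eq_or_ne u 0 with rfl | hu
  · simp
  have hd' : 0 < ‖d‖ := norm_pos_iff.2 hd
  have hu' : 0 < ‖u‖ := norm_pos_iff.2 hu
  set K := (ℓ - μ) * (‖d‖ * ‖u‖) - ℓ * ⟪d, u⟫ with hK
  let ψ : ℝ → ℝ := fun s =>
    g (y + d + s • (u - d)) - g (y + d + s • (-d)) - g (y + s • u) + g y
  have hψ₀ : ψ 0 = 0 := by simp [ψ]
  have hψ : HasDerivAt ψ ⟪G (y + d) - G y, u⟫ 0 := by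
    have k₁ := HasGradientAt.hasDerivAt_line (g := g) (a := y + d) (w := u - d) (t := 0) (hG _)
    have k₂ := HasGradientAt.hasDerivAt_line (g := g) (a := y + d) (w := -d) (t := 0) (hG _)
    have k₃ := HasGradientAt.hasDerivAt_line (g := g) (a := y) (w := u) (t := 0) (hG _)
    refine (((k₁.sub k₂).sub k₃).add_const (g y)).congr_deriv ?_
    simp only [zero_smul, add_zero, inner_sub_left, inner_sub_right, inner_neg_right]
    ring
  let s : ℕ → ℝ := fun N => ‖d‖ / (N * ‖u‖ + ‖d‖)
  have hs_pos (N : ℕ) : 0 < s N := by positivity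
  have hs_le (N : ℕ) : s N ≤ 1 := by
    refine div_le_one_of_le₀ ?_ (by positivity)
    have : 0 ≤ (N : ℝ) * ‖u‖ := by positivity
    linarith
  have hs : Tendsto s atTop (𝓝 0) :=
    tendsto_const_nhds.div_atTop
      (tendsto_atTop_add_const_right _ _ (tendsto_natCast_atTop_atTop.atTop_mul_const hu'))
  have hbound (N : ℕ) (hN : 0 < N) : ψ (s N) ≤ s N * ((1 - s N) * K) := by
    have hN' : (0 : ℝ) < N := by exact_mod_cast hN
    set σ := s N with hσ
    have hσ₀ : 0 < σ := hs_pos N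
    have hσ₁ : σ ≤ 1 := hs_le N
    have hside : (1 - σ) / N * ‖d‖ = σ * ‖u‖ := by
      have hne : (N : ℝ) * ‖u‖ + ‖d‖ ≠ 0 := by positivity
      simp only [hσ, s]
      field_simp
      ring
    let τ : ℝ := (1 - σ) / N
    have hτ : 0 ≤ τ := div_nonneg (by linarith) hN'.le
    have hNτ : N * τ = 1 - σ := by simp only [τ]; field_simp
    have hcell : ∀ i ∈ Finset.range N,
        (g (y + ((i + 1 : ℕ) * τ) • d + σ • u) - g (y + ((i + 1 : ℕ) * τ) • d)) -
          (g (y + (i * τ) • d + σ • u) - g (y + (i * τ) • d)) ≤ τ * σ * K := by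
      intro i hi
      have hi' : ((i + 1 : ℕ) : ℝ) ≤ N := by exact_mod_cast Finset.mem_range.1 hi
      have hi₁ : ((i + 1 : ℕ) : ℝ) * τ ≤ 1 - σ := by
        rw [← hNτ]; gcongr
      have e : y + (((i + 1 : ℕ) : ℝ) * τ) • d = y + (i * τ) • d + τ • d := by
        push_cast; module
      have hmem₀ : y + (i * τ) • d ∈ Y := by
        have := hg.1.add_smul_add_smul_mem h₀ h₁ h₂ (α := i * τ) (β := 0) (by positivity) le_rfl
          (by push_cast at hi₁; nlinarith)
        simpa using this
      have hmem₁ : y + (i * τ) • d + τ • d + σ • u ∈ Y := by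
        rw [← e]
        exact hg.1.add_smul_add_smul_mem h₀ h₁ h₂ (by positivity) hσ₀.le (by linarith)
      have h := hg.mixed_difference_le hμℓ
        (neg_le_second_difference_of_lipschitz_gradient hG hlip) (δ := τ • d) (v := σ • u)
        (by rw [norm_smul, norm_smul, Real.norm_of_nonneg hτ, Real.norm_of_nonneg hσ₀.le]
            exact hside) hmem₀ hmem₁
      rw [norm_smul, norm_smul, Real.norm_of_nonneg hτ, Real.norm_of_nonneg hσ₀.le,
        real_inner_smul_left, real_inner_smul_right] at h
      rw [e, hK]
      linarith
    have hsum := Finset.sum_le_sum hcell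
    rw [Finset.sum_range_sub
      (fun i : ℕ => g (y + ((i : ℝ) * τ) • d + σ • u) - g (y + ((i : ℝ) * τ) • d))] at hsum
    simp only [Finset.sum_const, Finset.card_range, nsmul_eq_mul, hNτ, Nat.cast_zero, zero_mul,
      zero_smul, add_zero] at hsum
    have e₁ : y + d + σ • (u - d) = y + (1 - σ) • d + σ • u := by module
    have e₂ : y + d + σ • (-d) = y + (1 - σ) • d := by module
    simp only [ψ, e₁, e₂]
    rw [show (N : ℝ) * (τ * σ * K) = σ * ((N * τ) * K) by ring, hNτ] at hsum
    linarith
  have hlim : Tendsto (fun N => (s N)⁻¹ * ψ (s N)) atTop (𝓝 ⟪G (y + d) - G y, u⟫) := by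
    have h := hψ.tendsto_slope_zero.comp (tendsto_nhdsWithin_iff.2
      ⟨hs, Eventually.of_forall fun N => (hs_pos N).ne'⟩)
    simpa [Function.comp_def, hψ₀] using h
  have hlim' : Tendsto (fun N => (1 - s N) * K) atTop (𝓝 K) := by
    simpa using (hs.const_sub 1).mul_const K
  refine le_of_tendsto_of_tendsto hlim hlim' ?_
  filter_upwards [eventually_gt_atTop 0] with N hN
  rw [inv_mul_le_iff₀ (hs_pos N)]
  exact hbound N hN

theorem inner_gradient_nonpos_of_isMaxOn {Y : Set E} (hY : Convex ℝ Y) {g : E → ℝ} {G y z : E}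
    (hG : HasGradientAt g G y) (hmax : IsMaxOn g Y y) (hy : y ∈ Y) (hz : z ∈ Y) :
    ⟪G, z - y⟫ ≤ 0 := by
  have h := hmax.localize.hasFDerivWithinAt_nonpos hG.hasFDerivAt.hasFDerivWithinAt
    (sub_mem_posTangentConeAt_of_segment_subset (hY.segment_subset hy hz))
  simpa using h

/-- The projected-gradient error bound for strongly concave maximization. -/
theorem StrongConcaveOn.error_bound {Y : Set E} {μ ℓ : ℝ} {g : E → ℝ} {G : E → E}
    (hg : StrongConcaveOn Y μ g) (hℓ : 0 < ℓ) (hμℓ : μ ≤ ℓ)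
    (hG : ∀ y, HasGradientAt g (G y) y) (hlip : ∀ y y', ‖G y - G y'‖ ≤ ℓ * ‖y - y'‖)
    {y z p : E} (hy : y ∈ Y) (hmax : IsMaxOn g Y y) (hz : z ∈ Y) (hp : p ∈ Y)
    (hproj : ⟪z + (1 / ℓ) • G z - p, y - p⟫ ≤ 0) :
    μ * ‖z - y‖ ≤ ℓ * ‖p - z‖ := by
  have hopt := inner_gradient_nonpos_of_isMaxOn hg.1 (hG y) hmax hy hp
  have hcontr := hg.inner_gradient_sub_le hμℓ hG hlip (d := z - y) (u := p - y) hy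
    (by simpa using hz) (by simpa using hp)
  rw [add_sub_cancel, inner_sub_left] at hcontr
  rw [show z + (1 / ℓ) • G z - p = (z - y) - (p - y) + (1 / ℓ) • G z by module,
    show y - p = -(p - y) by module, inner_neg_right, inner_add_left, inner_sub_left,
    real_inner_smul_left, real_inner_self_eq_norm_sq] at hproj
  have hproj' : ℓ * ‖p - y‖ ^ 2 ≤ ℓ * ⟪z - y, p - y⟫ + ⟪G z, p - y⟫ := by
    have h := mul_nonneg hℓ.le (neg_nonneg.2 hproj)
    field_simp at h
    linarith
  have hu : ℓ * ‖p - y‖ ≤ (ℓ - μ) * ‖z - y‖ := by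
    rcases (norm_nonneg (p - y)).eq_or_lt with h | h
    · rw [← h, mul_zero]
      exact mul_nonneg (sub_nonneg.2 hμℓ) (norm_nonneg _)
    · refine le_of_mul_le_mul_right ?_ h
      nlinarith
  have htri : ‖z - y‖ ≤ ‖p - z‖ + ‖p - y‖ := by
    rw [norm_sub_rev p z]
    exact norm_sub_le_norm_sub_add_norm_sub z p y
  nlinarith

end ErrorBound

/-- In the nonconvex-strongly-concave setting with `κ = ℓ/μ`, if
`(xh, yh)` satisfies `‖∇_x f(xh,yh)‖ ≤ ε/κ` and
`‖P_Y(yh + (1/ℓ)∇_y f(xh,yh)) − yh‖ ≤ ε/(κℓ)`, then `‖∇Φ(xh)‖ = ‖∇_x f(xh, y*(xh))‖ ≤ 2ε`. -/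
theorem statement15 {m n : ℕ} (f : EuclideanSpace ℝ (Fin m) → EuclideanSpace ℝ (Fin n) → ℝ)
    (ℓ μ ε : ℝ) (hℓ : 0 < ℓ) (hμ : 0 < μ) (hμℓ : μ ≤ ℓ) (hε : 0 ≤ ε)
    (Y : Set (EuclideanSpace ℝ (Fin n))) (hYconv : Convex ℝ Y) (hYclosed : IsClosed Y)
    (hYbdd : Bornology.IsBounded Y) (hYne : Y.Nonempty)
    (gx : EuclideanSpace ℝ (Fin m) → EuclideanSpace ℝ (Fin n) → EuclideanSpace ℝ (Fin m))
    (gy : EuclideanSpace ℝ (Fin m) → EuclideanSpace ℝ (Fin n) → EuclideanSpace ℝ (Fin n))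
    (hgx : ∀ x y, HasGradientAt (fun x' => f x' y) (gx x y) x)
    (hgy : ∀ x y, HasGradientAt (fun y' => f x y') (gy x y) y)
    (hsmooth : ∀ x x' y y',
      ‖gx x y - gx x' y'‖ ≤ ℓ * (‖x - x'‖ + ‖y - y'‖) ∧
      ‖gy x y - gy x' y'‖ ≤ ℓ * (‖x - x'‖ + ‖y - y'‖))
    (hconc : ∀ x, StrongConcaveOn Y μ (f x))
    (P : EuclideanSpace ℝ (Fin n) → EuclideanSpace ℝ (Fin n))
    (hP : ∀ z, P z ∈ Y ∧ ∀ y ∈ Y, ⟪z - P z, y - P z⟫ ≤ 0)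
    (ystar : EuclideanSpace ℝ (Fin m) → EuclideanSpace ℝ (Fin n))
    (hystar : ∀ x, ystar x ∈ Y ∧ IsMaxOn (f x) Y (ystar x))
    (xh : EuclideanSpace ℝ (Fin m)) (yh : EuclideanSpace ℝ (Fin n)) (hyh : yh ∈ Y)
    (h1 : ‖gx xh yh‖ ≤ ε / (ℓ / μ))
    (h2 : ‖P (yh + (1 / ℓ) • gy xh yh) - yh‖ ≤ ε / ((ℓ / μ) * ℓ)) :
    ‖gx xh (ystar xh)‖ ≤ 2 * ε := by
  obtain ⟨hy, hmax⟩ := hystar xh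
  obtain ⟨hp, hproj⟩ := hP (yh + (1 / ℓ) • gy xh yh)
  have hbound := (hconc xh).error_bound hℓ hμℓ (hgy xh)
    (fun y y' => by simpa using (hsmooth xh xh y y').2) hy hmax hyh hp (hproj _ hy)
  have hres : ℓ * ‖P (yh + (1 / ℓ) • gy xh yh) - yh‖ ≤ μ * (ε / ℓ) := by
    refine (mul_le_mul_of_nonneg_left h2 hℓ.le).trans_eq ?_
    field_simp
  have hdist : ℓ * ‖yh - ystar xh‖ ≤ ε := by
    rw [← le_div_iff₀' hℓ]
    exact le_of_mul_le_mul_left (hbound.trans hres) hμ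
  have hgrad : ‖gx xh (ystar xh) - gx xh yh‖ ≤ ℓ * ‖yh - ystar xh‖ := by
    simpa [norm_sub_rev] using (hsmooth xh xh yh (ystar xh)).1
  have hκ : ε / (ℓ / μ) ≤ ε := div_le_self hε ((one_le_div hμ).2 hμℓ)
  have htri := norm_le_norm_add_norm_sub' (gx xh (ystar xh)) (gx xh yh)
  linarith
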